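/- Let N ≥ 1, p > 1, and suppose N < 1 + (2/(p−1))(p + √(p(p−1))). Let ω₁, ω₂ : ℝ^N → ℝ be smooth positive functions such that: ω₂ is bounded on ℝ^N; and there is a constant C > 0 with ω₁(x) ≤ C ω₂(x) and |∇ω₁(x)| ≤ C ω₂(x) for all x with |x| sufficiently large. Then there is no positive stable sub-solution of the equation −div(ω₁ ∇u) = ω₂ u^p in ℝ^N. -/

import Mathlib

open MeasureTheory Filter Real
open scoped RealInnerProductSpace

noncomputable def vdiv {N : ℕ} (V : EuclideanSpace ℝ (Fin N) → EuclideanSpace ℝ (Fin N))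
    (x : EuclideanSpace ℝ (Fin N)) : ℝ :=
  LinearMap.trace ℝ (EuclideanSpace ℝ (Fin N)) (fderiv ℝ V x).toLinearMap

def annulus (N : ℕ) (R : ℝ) : Set (EuclideanSpace ℝ (Fin N)) :=
  {x | R < ‖x‖ ∧ ‖x‖ < 2 * R}

theorem HasCompactSupport.of_imp_eq_zero {X E F : Type*} [TopologicalSpace X] [Zero E] [Zero F]
    {f : X → E} {g : X → F} (hf : HasCompactSupport f) (h : ∀ x, f x = 0 → g x = 0) :
    HasCompactSupport g :=
  hf.mono fun x hx hfx => hx (h x hfx)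

theorem gradient_eq_sum_smul_basisFun {N : ℕ} (f : EuclideanSpace ℝ (Fin N) → ℝ) :
    gradient f = fun x => ∑ i, fderiv ℝ f x (EuclideanSpace.basisFun (Fin N) ℝ i) •
      EuclideanSpace.basisFun (Fin N) ℝ i := by
  funext x
  rw [← (EuclideanSpace.basisFun (Fin N) ℝ).sum_repr' (gradient f x)]
  refine Finset.sum_congr rfl fun i _ => ?_
  rw [real_inner_comm, inner_gradient_left]

theorem ContDiff.gradient {N : ℕ} {n m : WithTop ℕ∞} {f : EuclideanSpace ℝ (Fin N) → ℝ}
    (hf : ContDiff ℝ n f) (hmn : m + 1 ≤ n) : ContDiff ℝ m (gradient f) := by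
  rw [gradient_eq_sum_smul_basisFun]
  exact ContDiff.sum fun i _ =>
    ((hf.fderiv_right hmn).clm_apply contDiff_const).smul contDiff_const

theorem HasGradientAt.rpow_mul {N : ℕ} {u φ : EuclideanSpace ℝ (Fin N) → ℝ}
    {u' φ' x : EuclideanSpace ℝ (Fin N)} (hu : HasGradientAt u u' x) (hφ : HasGradientAt φ φ' x)
    (hx : u x ≠ 0) (k : ℝ) :
    HasGradientAt (fun y => u y ^ k * φ y)
      ((k * u x ^ (k - 1) * φ x) • u' + u x ^ k • φ') x := by
  rw [hasGradientAt_iff_hasFDerivAt] at *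
  refine ((hu.rpow_const (p := k) (Or.inl hx)).mul hφ).congr_fderiv ?_
  ext y
  simp
  ring

theorem HasGradientAt.pow {N : ℕ} {φ : EuclideanSpace ℝ (Fin N) → ℝ}
    {φ' x : EuclideanSpace ℝ (Fin N)} (hφ : HasGradientAt φ φ' x) (n : ℕ) :
    HasGradientAt (fun y => φ y ^ (n + 1)) (((n + 1) * φ x ^ n) • φ') x := by
  rw [hasGradientAt_iff_hasFDerivAt] at *
  refine (HasFDerivAt.pow hφ (n + 1)).congr_fderiv ?_
  ext y
  simp

theorem integral_vdiv_mul {N : ℕ} {V : EuclideanSpace ℝ (Fin N) → EuclideanSpace ℝ (Fin N)}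
    {v : EuclideanSpace ℝ (Fin N) → ℝ} (hV : ContDiff ℝ 1 V) (hv : ContDiff ℝ 1 v)
    (hc : HasCompactSupport v) :
    ∫ x, vdiv V x * v x = -∫ x, ⟪V x, gradient v x⟫ := by
  set b := EuclideanSpace.basisFun (Fin N) ℝ
  have hVi (i) : ContDiff ℝ 1 fun x => ⟪b i, V x⟫ := contDiff_const.inner ℝ hV
  have hd (i) : Continuous fun x => fderiv ℝ (fun x => ⟪b i, V x⟫) x (b i) :=
    ((hVi i).continuous_fderiv one_ne_zero).clm_apply continuous_const
  have hdv (i) : Continuous fun x => fderiv ℝ v x (b i) :=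
    (hv.continuous_fderiv one_ne_zero).clm_apply continuous_const
  have hcv (i) : HasCompactSupport fun x => fderiv ℝ v x (b i) :=
    hc.fderiv_apply ℝ (b i)
  have hdiv (x) : vdiv V x * v x = ∑ i, fderiv ℝ (fun x => ⟪b i, V x⟫) x (b i) * v x := by
    rw [← Finset.sum_mul, vdiv, LinearMap.trace_eq_sum_inner _ b]
    congr 1
    refine Finset.sum_congr rfl fun i _ => ?_
    rw [fderiv_inner_apply ℝ (differentiableAt_const _) (hV.differentiable one_ne_zero x)]
    simp
  have hinner (x) : ⟪V x, gradient v x⟫ = ∑ i, ⟪b i, V x⟫ * fderiv ℝ v x (b i) := by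
    rw [← b.sum_inner_mul_inner]
    refine Finset.sum_congr rfl fun i _ => ?_
    rw [real_inner_comm (b i) (V x), real_inner_comm (gradient v x), inner_gradient_left]
  have hI1 (i) : Integrable fun x => fderiv ℝ (fun x => ⟪b i, V x⟫) x (b i) * v x :=
    ((hd i).mul hv.continuous).integrable_of_hasCompactSupport hc.mul_left
  have hI2 (i) : Integrable fun x => ⟪b i, V x⟫ * fderiv ℝ v x (b i) :=
    ((hVi i).continuous.mul (hdv i)).integrable_of_hasCompactSupport (hcv i).mul_left
  have hI3 (i) : Integrable fun x => ⟪b i, V x⟫ * v x :=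
    ((hVi i).continuous.mul hv.continuous).integrable_of_hasCompactSupport hc.mul_left
  simp_rw [hdiv, hinner]
  rw [integral_finsetSum _ fun i _ => hI1 i, integral_finsetSum _ fun i _ => hI2 i,
    ← Finset.sum_neg_distrib]
  refine Finset.sum_congr rfl fun i _ => ?_
  rw [integral_mul_fderiv_eq_neg_fderiv_mul_of_integrable (hI1 i) (hI2 i) (hI3 i)
    (fun x _ => (hVi i).differentiable one_ne_zero x)
    (fun x _ => hv.differentiable one_ne_zero x), neg_neg]

/-- The energy estimate for stable sub-solutions, from testing the equation with
`u ^ (2 * p - 1) * φ ^ 2` and the stability inequality with `u ^ p * φ`. -/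
theorem stable_subsolution_integral_le {N : ℕ} {p : ℝ} (hp : 1 < p)
    {ω₁ ω₂ u φ : EuclideanSpace ℝ (Fin N) → ℝ}
    (hω₁ : ContDiff ℝ 1 ω₁) (hω₂ : Continuous ω₂) (hω₁pos : ∀ x, 0 < ω₁ x)
    (hu : ContDiff ℝ 2 u) (hupos : ∀ x, 0 < u x)
    (hsub : ∀ x, -vdiv (fun y => ω₁ y • gradient u y) x ≤ ω₂ x * u x ^ p)
    (hstab : ∀ ψ : EuclideanSpace ℝ (Fin N) → ℝ, ContDiff ℝ 2 ψ → HasCompactSupport ψ →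
      ∫ x, p * ω₂ x * u x ^ (p - 1) * ψ x ^ 2 ≤ ∫ x, ω₁ x * ‖gradient ψ x‖ ^ 2)
    (hφ : ContDiff ℝ 2 φ) (hφc : HasCompactSupport φ) :
    (p - 1) * ∫ x, ω₂ x * u x ^ (3 * p - 1) * φ x ^ 2 ≤
      (p + 1) * ∫ x, ω₁ x * (u x ^ (2 * p) * ‖gradient φ x‖ ^ 2) := by
  have hune (x) : u x ≠ 0 := (hupos x).ne'
  have hgu : ContDiff ℝ 1 (gradient u) := hu.gradient (by norm_num)
  have hgφ : ContDiff ℝ 1 (gradient φ) := hφ.gradient (by norm_num)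
  have hdu (x) := (hu.differentiable two_ne_zero x).hasGradientAt
  have hdφ (x) := (hφ.differentiable two_ne_zero x).hasGradientAt
  have hrp (k : ℝ) : Continuous fun x => u x ^ k :=
    hu.continuous.rpow_const fun x => Or.inl (hune x)
  set a := fun x => (u x ^ (p - 1) * φ x) • gradient u x with ha
  set b := fun x => u x ^ p • gradient φ x with hb
  have hac : Continuous a := ((hrp _).mul hφ.continuous).smul hgu.continuous
  have hbc : Continuous b := (hrp _).smul hgφ.continuous
  have has : HasCompactSupport a :=
    hφc.of_imp_eq_zero fun x hx => by simp [ha, hx]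
  have hφ' : HasCompactSupport (gradient φ) :=
    (hφc.fderiv ℝ).of_imp_eq_zero fun x hx => by simp [gradient, hx]
  have hbs : HasCompactSupport b :=
    hφ'.of_imp_eq_zero fun x hx => by simp [hb, hx]
  have hA : Integrable fun x => ω₁ x * ‖a x‖ ^ 2 :=
    (hω₁.continuous.mul (hac.norm.pow 2)).integrable_of_hasCompactSupport
      (has.of_imp_eq_zero fun x hx => by simp [hx])
  have hD : Integrable fun x => ω₁ x * ‖b x‖ ^ 2 :=
    (hω₁.continuous.mul (hbc.norm.pow 2)).integrable_of_hasCompactSupport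
      (hbs.of_imp_eq_zero fun x hx => by simp [hx])
  have hX : Integrable fun x => ω₁ x * ⟪a x, b x⟫ :=
    (hω₁.continuous.mul (hac.inner hbc)).integrable_of_hasCompactSupport
      (has.of_imp_eq_zero fun x hx => by simp [hx])
  have hB (k : ℝ) : Integrable fun x => ω₂ x * u x ^ k * φ x ^ 2 :=
    ((hω₂.mul (hrp k)).mul (hφ.continuous.pow 2)).integrable_of_hasCompactSupport
      (hφc.of_imp_eq_zero fun x hx => by simp [hx])
  have htest : (2 * p - 1) * (∫ x, ω₁ x * ‖a x‖ ^ 2) + 2 * (∫ x, ω₁ x * ⟪a x, b x⟫) ≤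
      ∫ x, ω₂ x * u x ^ (3 * p - 1) * φ x ^ 2 := by
    set v := fun x => u x ^ (2 * p - 1) * φ x ^ (1 + 1) with hv
    have hvC : ContDiff ℝ 1 v :=
      ((hu.rpow_const_of_ne hune).mul (hφ.pow _)).of_le (by norm_num)
    have hvs : HasCompactSupport v :=
      hφc.of_imp_eq_zero fun x hx => by simp [hv, hx]
    have hV : ContDiff ℝ 1 fun y => ω₁ y • gradient u y := hω₁.smul hgu
    have hibp := integral_vdiv_mul hV hvC hvs
    have hpt (x) : ⟪ω₁ x • gradient u x, gradient v x⟫ =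
        (2 * p - 1) * (ω₁ x * ‖a x‖ ^ 2) + 2 * (ω₁ x * ⟪a x, b x⟫) := by
      rw [((hdu x).rpow_mul ((hdφ x).pow 1) (hune x) (2 * p - 1)).gradient]
      have e1 : u x ^ (2 * p - 1 - 1) = u x ^ (p - 1) * u x ^ (p - 1) := by
        rw [← rpow_add (hupos x)]; ring_nf
      have e2 : u x ^ (2 * p - 1) = u x ^ (p - 1) * u x ^ p := by
        rw [← rpow_add (hupos x)]; ring_nf
      simp only [ha, hb, inner_add_right, real_inner_smul_left, real_inner_smul_right,
        ← real_inner_self_eq_norm_sq, e1, e2]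
      push_cast
      ring
    have hdivc : Continuous (vdiv fun y => ω₁ y • gradient u y) :=
      (LinearMap.continuous_of_finiteDimensional
        ((LinearMap.trace ℝ (EuclideanSpace ℝ (Fin N))).comp
          (ContinuousLinearMap.coeLM ℝ))).comp (hV.continuous_fderiv one_ne_zero)
    have hle : ∫ x, -vdiv (fun y => ω₁ y • gradient u y) x * v x ≤
        ∫ x, ω₂ x * u x ^ (3 * p - 1) * φ x ^ 2 := by
      refine integral_mono ((hdivc.neg.mul hvC.continuous).integrable_of_hasCompactSupport
        hvs.mul_left) (hB _) fun x => ?_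
      have hvx : 0 ≤ v x :=
        mul_nonneg (rpow_nonneg (hupos x).le _) (Even.pow_nonneg ⟨1, rfl⟩ _)
      refine (mul_le_mul_of_nonneg_right (hsub x) hvx).trans_eq ?_
      have e : u x ^ (3 * p - 1) = u x ^ p * u x ^ (2 * p - 1) := by
        rw [← rpow_add (hupos x)]; ring_nf
      simp only [hv, e]
      ring
    simp_rw [neg_mul] at hle
    rw [integral_neg, hibp, neg_neg] at hle
    simp_rw [hpt] at hle
    rwa [integral_add (hA.const_mul _) (hX.const_mul _), integral_const_mul,
      integral_const_mul] at hle
  have hstab' : p * (∫ x, ω₂ x * u x ^ (3 * p - 1) * φ x ^ 2) ≤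
      p ^ 2 * (∫ x, ω₁ x * ‖a x‖ ^ 2) + 2 * p * (∫ x, ω₁ x * ⟪a x, b x⟫) +
        ∫ x, ω₁ x * ‖b x‖ ^ 2 := by
    have h := hstab (fun x => u x ^ p * φ x) ((hu.rpow_const_of_ne hune).mul hφ) hφc.mul_left
    have hl (x) : p * ω₂ x * u x ^ (p - 1) * (u x ^ p * φ x) ^ 2 =
        p * (ω₂ x * u x ^ (3 * p - 1) * φ x ^ 2) := by
      have e : u x ^ (3 * p - 1) = u x ^ (p - 1) * u x ^ p * u x ^ p := by
        rw [← rpow_add (hupos x), ← rpow_add (hupos x)]; ring_nf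
      rw [e]
      ring
    have hr (x) : ω₁ x * ‖gradient (fun x => u x ^ p * φ x) x‖ ^ 2 =
        p ^ 2 * (ω₁ x * ‖a x‖ ^ 2) + 2 * p * (ω₁ x * ⟪a x, b x⟫) + ω₁ x * ‖b x‖ ^ 2 := by
      rw [((hdu x).rpow_mul (hdφ x) (hune x) p).gradient]
      simp only [ha, hb, inner_add_right, inner_add_left, real_inner_smul_left,
        real_inner_smul_right, ← real_inner_self_eq_norm_sq, real_inner_comm (gradient u x)]
      ring
    simp_rw [hl, hr] at h
    have hAX : Integrable fun x =>
        p ^ 2 * (ω₁ x * ‖a x‖ ^ 2) + 2 * p * (ω₁ x * ⟪a x, b x⟫) :=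
      (hA.const_mul _).add (hX.const_mul _)
    rwa [integral_add hAX hD,
      integral_add (hA.const_mul _) (hX.const_mul _), integral_const_mul, integral_const_mul,
      integral_const_mul] at h
  have hyoung : 2 * (∫ x, ω₁ x * ⟪a x, b x⟫) ≤
      (∫ x, ω₁ x * ‖a x‖ ^ 2) + ∫ x, ω₁ x * ‖b x‖ ^ 2 := by
    rw [← integral_const_mul, ← integral_add hA hD]
    refine integral_mono (hX.const_mul _) (hA.add hD) fun x => ?_
    have h1 := norm_sub_sq_real (a x) (b x)
    have h2 := mul_nonneg (hω₁pos x).le (sq_nonneg ‖a x - b x‖)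
    rw [h1] at h2
    dsimp only
    linarith
  have hDeq : ∫ x, ω₁ x * (u x ^ (2 * p) * ‖gradient φ x‖ ^ 2) = ∫ x, ω₁ x * ‖b x‖ ^ 2 := by
    congr 1
    funext x
    have e : u x ^ (2 * p) = u x ^ p * u x ^ p := by
      rw [← rpow_add (hupos x)]; ring_nf
    simp only [hb, norm_smul, norm_eq_abs, mul_pow, sq_abs, e]
    ring
  rw [hDeq]
  set A := ∫ x, ω₁ x * ‖a x‖ ^ 2
  set X := ∫ x, ω₁ x * ⟪a x, b x⟫
  set D := ∫ x, ω₁ x * ‖b x‖ ^ 2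
  set B := ∫ x, ω₂ x * u x ^ (3 * p - 1) * φ x ^ 2
  have hAD : p * (p - 1) * A ≤ D := by nlinarith
  have hBD : p * B ≤ (p + 1) * (p * A + D) := by nlinarith
  have : p * ((p - 1) * B) ≤ p * ((p + 1) * D) := by
    have h1 := mul_le_mul_of_nonneg_left hBD (sub_pos.2 hp).le
    have h2 := mul_le_mul_of_nonneg_left hAD (by linarith : 0 ≤ p + 1)
    linarith
  exact le_of_mul_le_mul_left this (by linarith)

theorem exists_cutoff (N : ℕ) : ∃ c : ℝ, 0 ≤ c ∧ ∀ R : ℝ, 0 < R →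
    ∃ η : EuclideanSpace ℝ (Fin N) → ℝ, ContDiff ℝ 2 η ∧ HasCompactSupport η ∧
      (∀ x, 0 ≤ η x) ∧ (∀ x, η x ≤ 1) ∧ (∀ x, ‖x‖ ≤ R → η x = 1) ∧
      (∀ x, 2 * R ≤ ‖x‖ → η x = 0) ∧ ∀ x, ‖gradient η x‖ ≤ c / R := by
  let η₁ : ContDiffBump (0 : EuclideanSpace ℝ (Fin N)) := ⟨1, 2, one_pos, one_lt_two⟩
  have hη₁ : ContDiff ℝ 2 η₁ := η₁.contDiff (n := 2)
  obtain ⟨c, hc⟩ := (η₁.hasCompactSupport.fderiv ℝ).exists_bound_of_continuous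
    (hη₁.continuous_fderiv two_ne_zero)
  refine ⟨c, (norm_nonneg _).trans (hc 0), fun R hR => ⟨fun x => η₁ (R⁻¹ • x),
    hη₁.comp (contDiff_const_smul _), η₁.hasCompactSupport.comp_smul (inv_ne_zero hR.ne'),
    fun x => η₁.nonneg, fun x => η₁.le_one, fun x hx => ?_, fun x hx => ?_, fun x => ?_⟩⟩
  · apply η₁.one_of_mem_closedBall
    rw [mem_closedBall_zero_iff, norm_smul, norm_inv, norm_of_nonneg hR.le]
    exact inv_mul_le_one_of_le₀ hx hR.le
  · apply η₁.zero_of_le_dist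
    rw [dist_zero_right, norm_smul, norm_inv, norm_of_nonneg hR.le, inv_mul_eq_div,
      le_div_iff₀ hR]
    exact hx
  · rw [gradient, LinearIsometryEquiv.norm_map, fderiv_comp_smul, norm_smul, norm_inv,
      norm_of_nonneg hR.le, inv_mul_eq_div]
    gcongr
    exact hc _

theorem young_rpow_mul_pow_le {p u h s : ℝ} {n : ℕ} (hp : 1 < p) (hu : 0 < u) (hh0 : 0 ≤ h)
    (hh1 : h ≤ 1) (hs : 0 ≤ s) (hn : 2 * p / (p - 1) ≤ n) :
    s * (u ^ (2 * p) * (h ^ n) ^ 2) ≤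
      u ^ (3 * p - 1) * (h ^ (n + 1)) ^ 2 / ((3 * p - 1) / (2 * p)) +
        s ^ ((3 * p - 1) / (p - 1)) / ((3 * p - 1) / (p - 1)) := by
  have hp1 : 0 < p - 1 := by linarith
  have hp3 : 0 < 3 * p - 1 := by linarith
  have hp0 : 0 < p := by linarith
  have hconj : ((3 * p - 1) / (2 * p)).HolderConjugate ((3 * p - 1) / (p - 1)) := by
    rw [Real.holderConjugate_iff]
    constructor
    · rw [lt_div_iff₀ (by linarith)]
      linarith
    · field_simp
      ring
  have ha : 0 ≤ u ^ (2 * p) * (h ^ n) ^ 2 := by positivity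
  rw [mul_comm s]
  refine (Real.young_inequality_of_nonneg ha hs hconj).trans ?_
  gcongr
  rw [mul_rpow (by positivity) (by positivity), ← rpow_mul hu.le,
    mul_div_cancel₀ _ (by positivity)]
  gcongr
  rw [← pow_mul, ← pow_mul, ← rpow_natCast, ← rpow_natCast, ← rpow_mul hh0]
  rcases hh0.eq_or_lt with rfl | hh
  · have hn0 : (0 : ℝ) < n := lt_of_lt_of_le (by positivity) hn
    rw [zero_rpow, zero_rpow]
    · push_cast; positivity
    · push_cast; positivity
  · refine rpow_le_rpow_of_exponent_ge hh hh1 ?_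
    rw [div_le_iff₀ hp1] at hn
    push_cast
    rw [← mul_div_assoc, le_div_iff₀ (by positivity)]
    nlinarith

theorem integral_cutoff_le {N : ℕ} {p : ℝ} (hp : 1 < p)
    {ω₁ ω₂ u : EuclideanSpace ℝ (Fin N) → ℝ}
    (hω₁ : ContDiff ℝ 1 ω₁) (hω₂ : Continuous ω₂) (hω₁pos : ∀ x, 0 < ω₁ x)
    (hω₂pos : ∀ x, 0 < ω₂ x) {M C c R : ℝ} (hM : ∀ x, ω₂ x ≤ M) (hC : 0 < C) (hR : 0 < R)
    (hcomp : ∀ x : EuclideanSpace ℝ (Fin N), R ≤ ‖x‖ → ω₁ x ≤ C * ω₂ x)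
    (hu : ContDiff ℝ 2 u) (hupos : ∀ x, 0 < u x)
    (hsub : ∀ x, -vdiv (fun y => ω₁ y • gradient u y) x ≤ ω₂ x * u x ^ p)
    (hstab : ∀ ψ : EuclideanSpace ℝ (Fin N) → ℝ, ContDiff ℝ 2 ψ → HasCompactSupport ψ →
      ∫ x, p * ω₂ x * u x ^ (p - 1) * ψ x ^ 2 ≤ ∫ x, ω₁ x * ‖gradient ψ x‖ ^ 2)
    {n : ℕ} (hn : 2 * p / (p - 1) ≤ n) {η : EuclideanSpace ℝ (Fin N) → ℝ}
    (hη : ContDiff ℝ 2 η) (hηc : HasCompactSupport η) (hη0 : ∀ x, 0 ≤ η x)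
    (hη1 : ∀ x, η x ≤ 1) (hηR : ∀ x, ‖x‖ ≤ R → η x = 1) (hη2R : ∀ x, 2 * R ≤ ‖x‖ → η x = 0)
    (hηg : ∀ x, ‖gradient η x‖ ≤ c / R) :
    ∫ x, ω₂ x * u x ^ (3 * p - 1) * (η x ^ (n + 1)) ^ 2 ≤
      ((p + 1) / (p - 1) * C * (n + 1) ^ 2 * (c / R) ^ 2) ^ ((3 * p - 1) / (p - 1)) * M *
        ((2 * R) ^ N * volume.real (Metric.ball (0 : EuclideanSpace ℝ (Fin N)) 1)) := by
  have hp1 : 0 < p - 1 := by linarith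
  have hp3 : 0 < 3 * p - 1 := by linarith
  have hp0 : 0 < p := by linarith
  have hn0 : n ≠ 0 := by
    rintro rfl
    have : 0 < 2 * p / (p - 1) := by positivity
    simp at hn
    linarith
  set φ := fun x => η x ^ (n + 1)
  have hφ : ContDiff ℝ 2 φ := hη.pow _
  have hφc : HasCompactSupport φ :=
    hηc.of_imp_eq_zero fun x hx => by simp [φ, hx]
  have hgφ (x) : gradient φ x = ((n + 1) * η x ^ n) • gradient η x :=
    ((hη.differentiable two_ne_zero x).hasGradientAt.pow n).gradient
  have hen := stable_subsolution_integral_le hp hω₁ hω₂ hω₁pos hu hupos hsub hstab hφ hφc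
  set s := (p + 1) / (p - 1) * C * (n + 1) ^ 2 * (c / R) ^ 2
  have hs : 0 ≤ s := by positivity
  set q := (3 * p - 1) / (2 * p) with hq
  set r := (3 * p - 1) / (p - 1) with hr
  have hq0 : 0 < q := by positivity
  have hr0 : 0 < r := by positivity
  set S := Metric.closedBall (0 : EuclideanSpace ℝ (Fin N)) (2 * R)
  have hpt (x) : (p + 1) / (p - 1) * (ω₁ x * (u x ^ (2 * p) * ‖gradient φ x‖ ^ 2)) ≤
      ω₂ x * u x ^ (3 * p - 1) * φ x ^ 2 / q + S.indicator (fun _ => s ^ r / r * M) x := by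
    have hux := hupos x
    have hωx := hω₂pos x
    have hMx := hM x
    have hM0 : 0 ≤ M := hωx.le.trans hMx
    have hrhs : 0 ≤ ω₂ x * u x ^ (3 * p - 1) * φ x ^ 2 / q +
        S.indicator (fun _ => s ^ r / r * M) x :=
      add_nonneg (by positivity) (Set.indicator_nonneg (fun _ _ => by positivity) _)
    rcases lt_or_ge ‖x‖ R with hx | hx
    · have hev : η =ᶠ[nhds x] fun _ => 1 := by
        filter_upwards [(isOpen_lt continuous_norm continuous_const).mem_nhds hx] with y hy
        exact hηR y (le_of_lt hy)
      rw [hgφ, hev.gradient_eq, gradient_fun_const]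
      simpa using hrhs
    rcases lt_or_ge (2 * R) ‖x‖ with hx2 | hx2
    · rw [hgφ, hη2R x hx2.le]
      simpa [hn0] using hrhs
    rw [Set.indicator_of_mem (by simpa [S] using hx2)]
    have hy := young_rpow_mul_pow_le hp hux (hη0 x) (hη1 x) hs hn
    calc (p + 1) / (p - 1) * (ω₁ x * (u x ^ (2 * p) * ‖gradient φ x‖ ^ 2))
        ≤ (p + 1) / (p - 1) * ((C * ω₂ x) * (u x ^ (2 * p) *
            (((n + 1) * η x ^ n) * (c / R)) ^ 2)) := by
          have h0 := hη0 x
          have hng : ‖gradient φ x‖ ≤ ((n + 1) * η x ^ n) * (c / R) := by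
            rw [hgφ, norm_smul, norm_of_nonneg (by positivity)]
            gcongr
            exact hηg x
          have := hcomp x hx
          gcongr
      _ = ω₂ x * (s * (u x ^ (2 * p) * (η x ^ n) ^ 2)) := by
          simp only [s]
          ring
      _ ≤ ω₂ x * (u x ^ (3 * p - 1) * φ x ^ 2 / q + s ^ r / r) := by gcongr
      _ = ω₂ x * u x ^ (3 * p - 1) * φ x ^ 2 / q + s ^ r / r * ω₂ x := by ring
      _ ≤ _ := by gcongr
  have hrp (k : ℝ) : Continuous fun x => u x ^ k :=
    hu.continuous.rpow_const fun x => Or.inl (hupos x).ne'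
  have hB : Integrable fun x => ω₂ x * u x ^ (3 * p - 1) * φ x ^ 2 :=
    ((hω₂.mul (hrp _)).mul (hφ.continuous.pow 2)).integrable_of_hasCompactSupport
      (hφc.of_imp_eq_zero fun x hx => by simp [hx])
  have hind : Integrable (S.indicator fun _ => s ^ r / r * M) :=
    (integrable_indicator_iff Metric.isClosed_closedBall.measurableSet).2
      (integrableOn_const (isCompact_closedBall _ _).measure_lt_top.ne)
  have hint := integral_mono_of_nonneg (ae_of_all _ fun x => ?_) ((hB.div_const q).add hind)
    (ae_of_all _ hpt)
  · simp only [Pi.add_apply] at hint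
    rw [integral_const_mul, integral_add (hB.div_const q) hind, integral_div,
      integral_indicator_const _ Metric.isClosed_closedBall.measurableSet,
      Measure.addHaar_real_closedBall _ _ (by positivity), finrank_euclideanSpace_fin,
      smul_eq_mul] at hint
    set B := ∫ x, ω₂ x * u x ^ (3 * p - 1) * φ x ^ 2
    set W := (2 * R) ^ N * volume.real (Metric.ball (0 : EuclideanSpace ℝ (Fin N)) 1)
    have hBle : B ≤ B / q + W * (s ^ r / r * M) := by
      refine le_trans ?_ hint
      rw [div_mul_eq_mul_div, le_div_iff₀ hp1, mul_comm]
      exact hen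
    have hqr : B - B / q = B / r := by
      simp only [hq, hr]
      field_simp
      ring
    have : B / r ≤ s ^ r * M * W / r := by
      rw [← hqr]
      calc B - B / q ≤ W * (s ^ r / r * M) := by linarith
        _ = _ := by ring
    exact (div_le_div_iff_of_pos_right hr0).1 this
  · have := hω₁pos x
    have := hupos x
    simp only [Pi.zero_apply]
    positivity

theorem tendsto_rpow_div_sq_mul_pow_atTop {K r M V : ℝ} {N : ℕ} (hK : 0 ≤ K) (c : ℝ)
    (hN : N < 2 * r) :
    Tendsto (fun R : ℝ => (K * (c / R) ^ 2) ^ r * M * ((2 * R) ^ N * V)) atTop (nhds 0) := by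
  have h := (tendsto_rpow_neg_atTop (sub_pos.2 hN)).const_mul
    ((K * c ^ 2) ^ r * M * 2 ^ N * V)
  rw [mul_zero] at h
  refine h.congr' ?_
  filter_upwards [eventually_gt_atTop 0] with R hR
  have e : (K * (c / R) ^ 2) ^ r = (K * c ^ 2) ^ r * R ^ (-(2 * r)) := by
    rw [div_pow, ← mul_div_assoc, div_rpow (by positivity) (by positivity), rpow_neg hR.le,
      rpow_mul hR.le, rpow_two, div_eq_mul_inv]
  rw [e, neg_sub, sub_eq_add_neg, add_comm, rpow_add hR, rpow_natCast]
  ring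

theorem stmt_13 (N : ℕ) (hN : 1 ≤ N) (p : ℝ) (hp : 1 < p)
    (hdim : (N : ℝ) < 1 + 2/(p - 1) * (p + Real.sqrt (p * (p - 1))))
    (ω₁ ω₂ : EuclideanSpace ℝ (Fin N) → ℝ)
    (hω₁ : ContDiff ℝ (⊤ : ℕ∞) ω₁) (hω₂ : ContDiff ℝ (⊤ : ℕ∞) ω₂)
    (hω₁pos : ∀ x, 0 < ω₁ x) (hω₂pos : ∀ x, 0 < ω₂ x)
    (hbdd : ∃ M : ℝ, ∀ x, ω₂ x ≤ M)
    (hcomp : ∃ C : ℝ, 0 < C ∧ ∃ R₀ : ℝ, ∀ x : EuclideanSpace ℝ (Fin N), R₀ ≤ ‖x‖ →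
      ω₁ x ≤ C * ω₂ x ∧ ‖gradient ω₁ x‖ ≤ C * ω₂ x) :
    ¬ ∃ u : EuclideanSpace ℝ (Fin N) → ℝ, ContDiff ℝ 2 u ∧ (∀ x, 0 < u x) ∧
      (∀ x, -vdiv (fun y => ω₁ y • gradient u y) x ≤ ω₂ x * u x ^ p) ∧
      (∀ ψ : EuclideanSpace ℝ (Fin N) → ℝ, ContDiff ℝ 2 ψ → HasCompactSupport ψ →
        ∫ x, p * ω₂ x * u x ^ (p - 1) * ψ x ^ 2 ≤ ∫ x, ω₁ x * ‖gradient ψ x‖ ^ 2) := by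
  rintro ⟨u, hu, hupos, hsub, hstab⟩
  obtain ⟨M, hM⟩ := hbdd
  obtain ⟨C, hC, R₀, hcomp⟩ := hcomp
  obtain ⟨c, -, hcut⟩ := exists_cutoff N
  obtain ⟨n, hn⟩ := exists_nat_ge (2 * p / (p - 1))
  have hp1 : 0 < p - 1 := by linarith
  have hN2 : (N : ℝ) < 2 * ((3 * p - 1) / (p - 1)) := by
    have hsqrt : √(p * (p - 1)) ≤ p := by
      rw [Real.sqrt_le_left (by linarith)]
      nlinarith
    calc (N : ℝ) < 1 + 2 / (p - 1) * (p + √(p * (p - 1))) := hdim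
      _ ≤ 1 + 2 / (p - 1) * (p + p) := by gcongr
      _ ≤ 2 * ((3 * p - 1) / (p - 1)) := by
        rw [← sub_nonneg]
        have : 2 * ((3 * p - 1) / (p - 1)) - (1 + 2 / (p - 1) * (p + p)) = 1 := by
          field_simp
          ring
        rw [this]
        exact zero_le_one
  have hrp : Continuous fun x => u x ^ (3 * p - 1) :=
    hu.continuous.rpow_const fun x => Or.inl (hupos x).ne'
  have hcont {η : EuclideanSpace ℝ (Fin N) → ℝ} (hη : ContDiff ℝ 2 η) (k : ℕ) :
      Continuous fun x => ω₂ x * u x ^ (3 * p - 1) * (η x ^ (k + 1)) ^ 2 :=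
    (hω₂.continuous.mul hrp).mul ((hη.continuous.pow _).pow 2)
  have hsupp {η : EuclideanSpace ℝ (Fin N) → ℝ} (hη : HasCompactSupport η) (k : ℕ) :
      HasCompactSupport fun x => ω₂ x * u x ^ (3 * p - 1) * (η x ^ (k + 1)) ^ 2 :=
    hη.of_imp_eq_zero fun x hx => by simp [hx]
  have hnonneg (η : EuclideanSpace ℝ (Fin N) → ℝ) (k : ℕ) (x) :
      0 ≤ ω₂ x * u x ^ (3 * p - 1) * (η x ^ (k + 1)) ^ 2 := by
    have := hω₂pos x
    have := hupos x
    positivity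
  obtain ⟨θ, hθ, hθc, hθ0, hθ1, hθin, hθout, -⟩ := hcut (1 / 2) (by norm_num)
  have hpos : 0 < ∫ x, ω₂ x * u x ^ (3 * p - 1) * (θ x ^ (0 + 1)) ^ 2 := by
    refine (hcont hθ 0).integral_pos_of_hasCompactSupport_nonneg_nonzero (hsupp hθc 0)
      (hnonneg θ 0) (x := 0) ?_
    have h1 := (hω₂pos 0).ne'
    have h2 := (rpow_pos_of_pos (hupos 0) (3 * p - 1)).ne'
    simp [hθin 0 (by simp), h1, h2]
  have hlim := tendsto_rpow_div_sq_mul_pow_atTop (M := M)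
    (V := volume.real (Metric.ball (0 : EuclideanSpace ℝ (Fin N)) 1))
    (K := (p + 1) / (p - 1) * C * (n + 1) ^ 2) (by positivity) c hN2
  obtain ⟨R, hRlt, hR1, hR0⟩ := ((hlim.eventually_lt_const hpos).and
    ((eventually_ge_atTop 1).and (eventually_ge_atTop R₀))).exists
  have hRpos : 0 < R := by linarith
  obtain ⟨η, hη, hηc, hη0, hη1, hηR, hη2R, hηg⟩ := hcut R hRpos
  have hle := integral_cutoff_le hp (hω₁.of_le (by exact_mod_cast le_top)) hω₂.continuous
    hω₁pos hω₂pos hM hC hRpos (fun x hx => (hcomp x (hR0.trans hx)).1) hu hupos hsub hstab hn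
    hη hηc hη0 hη1 hηR hη2R hηg
  refine (hle.trans_lt hRlt).not_ge ?_
  refine integral_mono ((hcont hθ 0).integrable_of_hasCompactSupport (hsupp hθc 0))
    ((hcont hη n).integrable_of_hasCompactSupport (hsupp hηc n)) fun x => ?_
  rcases le_total ‖x‖ 1 with hx | hx
  · have := hω₂pos x
    have := hupos x
    have h1 := hθ0 x
    have h2 := hθ1 x
    simp only [hηR x (hx.trans hR1)]
    gcongr
    simpa using h2
  · simpa [hθout x (by linarith)] using hnonneg η n x
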